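/- For every proper L^0(m)-normed L^0(m)-module M there exists a measurable Banach bundle T over X such that Γ(T) is isomorphic to M, i.e. there is an L^0(m)-linear bijection I : Γ(T) → M with |I(s)| = |s| m-a.e. for all s. -/

import Mathlib

open MeasureTheory

namespace L0SerreSwan

variable {X : Type*} [MeasurableSpace X]

/-- The commutative ring structure on `L⁰(m)`, the space of (m-a.e. equivalence classes
of) real-valued Borel functions, with pointwise operations. -/
noncomputable instance L0.instCommRing {μ : Measure X} : CommRing (X →ₘ[μ] ℝ) :=
  { (inferInstance : AddCommGroup (X →ₘ[μ] ℝ)),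
    (inferInstance : CommMonoid (X →ₘ[μ] ℝ)) with
    left_distrib := fun f g h => by
      refine AEEqFun.induction_on₃ f g h fun f hf g hg h hh => ?_
      simp only [AEEqFun.mk_add_mk, AEEqFun.mk_mul_mk]
      exact AEEqFun.mk_eq_mk.2 (Filter.Eventually.of_forall fun x => mul_add _ _ _)
    right_distrib := fun f g h => by
      refine AEEqFun.induction_on₃ f g h fun f hf g hg h hh => ?_
      simp only [AEEqFun.mk_add_mk, AEEqFun.mk_mul_mk]
      exact AEEqFun.mk_eq_mk.2 (Filter.Eventually.of_forall fun x => add_mul _ _ _)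
    zero_mul := fun f => by
      refine AEEqFun.induction_on f fun f hf => ?_
      have h0 : (0 : X →ₘ[μ] ℝ) = AEEqFun.mk (fun _ => (0:ℝ)) aestronglyMeasurable_const := rfl
      rw [h0, AEEqFun.mk_mul_mk]
      exact AEEqFun.mk_eq_mk.2 (Filter.Eventually.of_forall fun x => zero_mul _)
    mul_zero := fun f => by
      refine AEEqFun.induction_on f fun f hf => ?_
      have h0 : (0 : X →ₘ[μ] ℝ) = AEEqFun.mk (fun _ => (0:ℝ)) aestronglyMeasurable_const := rfl
      rw [h0, AEEqFun.mk_mul_mk]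
      exact AEEqFun.mk_eq_mk.2 (Filter.Eventually.of_forall fun x => mul_zero _) }

/-- `χ_A`, the (class of the) indicator function of a Borel set `A`, as an element of `L⁰(m)`. -/
noncomputable def chi (μ : Measure X) (A : Set X) (hA : MeasurableSet A) : X →ₘ[μ] ℝ :=
  AEEqFun.mk (A.indicator fun _ => (1:ℝ)) ((measurable_const.indicator hA).aestronglyMeasurable)

/-- `v_1, …, v_n` form a local basis for the `L⁰(m)`-module `M` on the Borel set `A`:
the elements `χ_A • v_i` generate `χ_A • M` over `L⁰(m|_A)` and are independent. -/
def LocalBasisOn (μ : Measure X) {M : Type*} [AddCommGroup M] [Module (X →ₘ[μ] ℝ) M]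
    (A : Set X) (hA : MeasurableSet A) {n : ℕ} (v : Fin n → M) : Prop :=
  (∀ w : M, ∃ f : Fin n → (X →ₘ[μ] ℝ),
      chi μ A hA • w = ∑ i, (chi μ A hA * f i) • v i) ∧
  (∀ f : Fin n → (X →ₘ[μ] ℝ),
      (∑ i, (chi μ A hA * f i) • v i) = 0 → ∀ i, chi μ A hA * f i = 0)

/-- The locality property of an `L⁰(m)`-module `M`: if `χ_{A_n} • v = 0` for all `n`
then `χ_{⋃ₙ A_n} • v = 0`. -/
def Locality (μ : Measure X) (M : Type*) [AddCommGroup M] [Module (X →ₘ[μ] ℝ) M] : Prop :=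
  ∀ (v : M) (A : ℕ → Set X) (hA : ∀ n, MeasurableSet (A n)),
    (∀ n, chi μ (A n) (hA n) • v = 0) →
    chi μ (⋃ n, A n) (MeasurableSet.iUnion hA) • v = 0

/-- The glueing property of an `L⁰(m)`-module `M`: given pairwise disjoint Borel sets
`A_n` and elements `v_n ∈ M`, there is `v ∈ M` with `χ_{A_n} • v = χ_{A_n} • v_n` for all `n`. -/
def Glueing (μ : Measure X) (M : Type*) [AddCommGroup M] [Module (X →ₘ[μ] ℝ) M] : Prop :=
  ∀ (v : ℕ → M) (A : ℕ → Set X) (hA : ∀ n, MeasurableSet (A n)),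
    (∀ n k, n ≠ k → Disjoint (A n) (A k)) →
    ∃ w : M, ∀ n, chi μ (A n) (hA n) • w = chi μ (A n) (hA n) • v n

/-- `(E_n)_{n∈ℕ}` together with `E_∞` is a dimensional decomposition of the
`L⁰(m)`-module `M`: it is a Borel partition of `X`, `M` has dimension `n` on each `E_n`
of positive measure, and `M` admits no finite local basis on any positive-measure
Borel subset of `E_∞`. -/
def DimDecomp (μ : Measure X) (M : Type*) [AddCommGroup M] [Module (X →ₘ[μ] ℝ) M]
    (E : ℕ → Set X) (hE : ∀ n, MeasurableSet (E n))
    (Einf : Set X) (hEinf : MeasurableSet Einf) : Prop :=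
  (∀ n k, n ≠ k → Disjoint (E n) (E k)) ∧
  (∀ n, Disjoint (E n) Einf) ∧
  ((⋃ n, E n) ∪ Einf = Set.univ) ∧
  (∀ n, 0 < μ (E n) → ∃ v : Fin n → M, LocalBasisOn μ (E n) (hE n) v) ∧
  (∀ (A : Set X) (hA : MeasurableSet A), A ⊆ Einf → 0 < μ A →
      ¬ ∃ (n : ℕ) (v : Fin n → M), LocalBasisOn μ A hA v)

/-- A pointwise norm turning the `L⁰(m)`-module `M` into an `L⁰(m)`-normed `L⁰(m)`-module:
`|v| ≥ 0`, `|f•v| = |f||v|` m-a.e., `|v| = 0` a.e. iff `v = 0`, the pointwise triangle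
inequality holds, and the distance `d_M(v,w) = ∫ |v-w| ∧ 1 dm'` is complete (here `m'` is
a probability measure mutually absolutely continuous with `m`). -/
structure PtNormedMod (μ m' : Measure X) (M : Type*)
    [AddCommGroup M] [Module (X →ₘ[μ] ℝ) M] where
  pn : M → (X →ₘ[μ] ℝ)
  pn_nonneg : ∀ v : M, ∀ᵐ x ∂μ, 0 ≤ pn v x
  pn_smul : ∀ (f : X →ₘ[μ] ℝ) (v : M), ⇑(pn (f • v)) =ᵐ[μ] fun x => |f x| * pn v x
  pn_add : ∀ v w : M, ∀ᵐ x ∂μ, pn (v + w) x ≤ pn v x + pn w x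
  pn_definite : ∀ v : M, (∀ᵐ x ∂μ, pn v x = 0) → v = 0
  complete : ∀ u : ℕ → M,
    (∀ ε > (0:ℝ), ∃ N, ∀ p ≥ N, ∀ q ≥ N,
      (∫ x, min (pn (u p - u q) x) 1 ∂m') < ε) →
    ∃ v : M, Filter.Tendsto (fun k => ∫ x, min (pn (u k - v) x) 1 ∂m')
      Filter.atTop (nhds 0)

/-- The distance `d_M(v,w) = ∫ |v-w| ∧ 1 dm'` on an `L⁰(m)`-normed `L⁰(m)`-module. -/
noncomputable def modDist {μ m' : Measure X} {M : Type*}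
    [AddCommGroup M] [Module (X →ₘ[μ] ℝ) M]
    (P : PtNormedMod μ m' M) (v w : M) : ℝ :=
  ∫ x, min (P.pn (v - w) x) 1 ∂m'

/-- A measurable Banach bundle over `(X,d,m)`: a Borel partition `(E_n)_{n∈ℕ}` of `X`,
with total space `⊔ₙ Eₙ × ℝⁿ`, together with a measurable function `nrm` assigning to
`m`-a.e. point `x ∈ E_n` a norm `nrm n x ·` on the fiber `ℝⁿ`. -/
structure MBB (X : Type*) [MeasurableSpace X] (μ : MeasureTheory.Measure X) where
  E : ℕ → Set X
  measE : ∀ n, MeasurableSet (E n)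
  disjE : ∀ n m, n ≠ m → Disjoint (E n) (E m)
  unionE : (⋃ n, E n) = Set.univ
  nrm : (n : ℕ) → X → (Fin n → ℝ) → ℝ
  meas_nrm : ∀ n, Measurable (fun p : X × (Fin n → ℝ) => nrm n p.1 p.2)
  nrm_nonneg : ∀ n, ∀ᵐ x ∂μ, x ∈ E n → ∀ v, 0 ≤ nrm n x v
  nrm_definite : ∀ n, ∀ᵐ x ∂μ, x ∈ E n → ∀ v, nrm n x v = 0 → v = 0
  nrm_smul : ∀ n, ∀ᵐ x ∂μ, x ∈ E n → ∀ (c : ℝ) (v), nrm n x (c • v) = |c| * nrm n x v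
  nrm_triangle : ∀ n, ∀ᵐ x ∂μ, x ∈ E n → ∀ v w, nrm n x (v + w) ≤ nrm n x v + nrm n x w

variable {μ : MeasureTheory.Measure X}

/-- A measurable section of a measurable Banach bundle, recorded by its values
`val n x ∈ ℝⁿ` (only the values for `x ∈ E_n` are relevant). -/
structure Sec (B : MBB X μ) where
  val : (n : ℕ) → X → Fin n → ℝ
  meas : ∀ n, Measurable (val n)

/-- Two sections agree `m`-a.e. (fiberwise, on each piece of the partition). -/
def Sec.aeeq (B : MBB X μ) (s t : Sec B) : Prop :=
  ∀ n, ∀ᵐ x ∂μ, x ∈ B.E n → s.val n x = t.val n x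

/-- Pointwise sum of sections. -/
def Sec.add {B : MBB X μ} (s t : Sec B) : Sec B :=
  ⟨fun n x i => s.val n x i + t.val n x i, fun n =>
    measurable_pi_lambda _ fun i =>
      ((measurable_pi_apply i).comp (s.meas n)).add
        ((measurable_pi_apply i).comp (t.meas n))⟩

/-- Pointwise difference of sections. -/
def Sec.sub {B : MBB X μ} (s t : Sec B) : Sec B :=
  ⟨fun n x i => s.val n x i - t.val n x i, fun n =>
    measurable_pi_lambda _ fun i =>
      ((measurable_pi_apply i).comp (s.meas n)).sub
        ((measurable_pi_apply i).comp (t.meas n))⟩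

/-- Multiplication of a section by a (Borel representative of an) `L⁰` function. -/
def Sec.smul {B : MBB X μ} (g : X → ℝ) (hg : Measurable g) (s : Sec B) : Sec B :=
  ⟨fun n x i => g x * s.val n x i, fun n =>
    measurable_pi_lambda _ fun i =>
      hg.mul ((measurable_pi_apply i).comp (s.meas n))⟩

/-- The pointwise norm `|s|(x) = nrm(s(x))` of a section. -/
noncomputable def ptNorm (B : MBB X μ) (s : Sec B) : X → ℝ :=
  fun x => ∑' n, (B.E n).indicator (fun y => B.nrm n y (s.val n y)) x

/-- The distance `d(s,t) = ∫ |s-t| ∧ 1 dm'` on sections. -/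
noncomputable def secDist (B : MBB X μ) (m' : MeasureTheory.Measure X) (s t : Sec B) : ℝ :=
  ∫ x, min (ptNorm B (s.sub t) x) 1 ∂m'

/-- The constant section associated to a vector `q ∈ ℝⁿ`: it equals `q` on `E_n` and
vanishes on the other pieces of the partition. -/
def constSec (B : MBB X μ) (n : ℕ) (q : Fin n → ℝ) : Sec B :=
  ⟨fun k _x i => if h : k = n then q (Fin.cast h i) else 0,
   fun _k => measurable_const⟩

/-- A finite `L⁰`-linear combination `∑ᵢ gᵢ • uᵢ` of sections. -/
def lincomb {B : MBB X μ} {k : ℕ} (g : Fin k → X → ℝ) (hg : ∀ i, Measurable (g i))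
    (u : Fin k → Sec B) : Sec B :=
  ⟨fun n x j => ∑ i, g i x * (u i).val n x j, fun n =>
    measurable_pi_lambda _ fun j =>
      Finset.measurable_sum _ fun i _ =>
        (hg i).mul ((measurable_pi_apply j).comp ((u i).meas n))⟩


/-- seminorm on `ℝⁿ`, as a predicate. -/
structure IsSN {n : ℕ} (p : (Fin n → ℝ) → ℝ) : Prop where
  nonneg : ∀ v, 0 ≤ p v
  smul : ∀ (c : ℝ) v, p (c • v) = |c| * p v
  tri : ∀ v w, p (v + w) ≤ p v + p w
  cont : Continuous p

/-- McShane type extension from rational vectors. -/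
noncomputable def ext {n : ℕ} (N : (Fin n → ℚ) → ℝ) (L : Fin n → ℝ) (v : Fin n → ℝ) : ℝ :=
  ⨅ q : Fin n → ℚ, (|N q| + ∑ i, |v i - q i| * |L i|)

theorem ext_bdd {n : ℕ} (N : (Fin n → ℚ) → ℝ) (L : Fin n → ℝ) (v : Fin n → ℝ) :
    BddBelow (Set.range fun q : Fin n → ℚ => (|N q| + ∑ i, |v i - q i| * |L i|)) := by
  refine ⟨0, ?_⟩
  rintro _ ⟨q, rfl⟩
  positivity

theorem ext_le {n : ℕ} (N : (Fin n → ℚ) → ℝ) (L : Fin n → ℝ) (v : Fin n → ℝ) (q : Fin n → ℚ) :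
    ext N L v ≤ |N q| + ∑ i, |v i - q i| * |L i| := ciInf_le (ext_bdd N L v) q

theorem le_ext {n : ℕ} (N : (Fin n → ℚ) → ℝ) (L : Fin n → ℝ) (v : Fin n → ℝ) (c : ℝ)
    (h : ∀ q : Fin n → ℚ, c ≤ |N q| + ∑ i, |v i - q i| * |L i|) : c ≤ ext N L v := le_ciInf h

theorem exists_rat_approx {n : ℕ} (v : Fin n → ℝ) (δ : ℝ) (hδ : 0 < δ) :
    ∃ q : Fin n → ℚ, ∀ i, |v i - q i| < δ := by
  have h : ∀ i, ∃ q : ℚ, |v i - q| < δ := fun i => exists_rat_near (v i) hδ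
  choose q hq using h
  exact ⟨q, hq⟩

theorem ext_eq_of {n : ℕ} (N : (Fin n → ℚ) → ℝ) (L : Fin n → ℝ) (v : Fin n → ℝ) (F : ℝ)
    (h1 : ∀ q : Fin n → ℚ, F ≤ |N q| + ∑ i, |v i - q i| * |L i|)
    (h2 : ∀ q : Fin n → ℚ, |N q| ≤ F + ∑ i, |v i - q i| * |L i|) : ext N L v = F := by
  refine le_antisymm ?_ (le_ext _ _ _ _ h1)
  refine le_of_forall_pos_le_add fun ε hε => ?_
  set S := ∑ i, |L i| with hS
  have hS0 : 0 ≤ S := by positivity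
  obtain ⟨q, hq⟩ := exists_rat_approx v (ε / (2 * (S + 1))) (by positivity)
  have h3 : ∑ i, |v i - q i| * |L i| ≤ ε / (2 * (S + 1)) * S := by
    rw [hS, Finset.mul_sum]
    exact Finset.sum_le_sum fun i _ => mul_le_mul_of_nonneg_right (hq i).le (abs_nonneg _)
  have h4 : ε / (2 * (S + 1)) * S ≤ ε / 2 := by
    rw [div_mul_eq_mul_div, div_le_div_iff₀ (by positivity) (by positivity)]
    nlinarith
  linarith [ext_le N L v q, h2 q]

theorem ext_lip {n : ℕ} (N : (Fin n → ℚ) → ℝ) (L : Fin n → ℝ) (v w : Fin n → ℝ) :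
    ext N L v ≤ ext N L w + ∑ i, |v i - w i| * |L i| := by
  rw [← sub_le_iff_le_add]
  refine le_ext _ _ _ _ fun q => ?_
  have := ext_le N L v q
  have h : ∑ i, |v i - q i| * |L i| ≤ ∑ i, |w i - q i| * |L i| + ∑ i, |v i - w i| * |L i| := by
    rw [← Finset.sum_add_distrib]
    refine Finset.sum_le_sum fun i _ => ?_
    rw [← add_mul]
    refine mul_le_mul_of_nonneg_right ?_ (abs_nonneg _)
    have := abs_sub_le (v i) (w i) (q i)
    linarith
  linarith

theorem ext_cont {n : ℕ} (N : (Fin n → ℚ) → ℝ) (L : Fin n → ℝ) : Continuous (ext N L) := by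
  rw [continuous_iff_continuousAt]
  intro w
  have h0 : Filter.Tendsto (fun v : Fin n → ℝ => ∑ i, |v i - w i| * |L i|) (nhds w) (nhds 0) := by
    have : Continuous (fun v : Fin n → ℝ => ∑ i, |v i - w i| * |L i|) := by fun_prop
    simpa using this.tendsto w
  refine tendsto_iff_dist_tendsto_zero.2 (squeeze_zero (fun _ => dist_nonneg) (fun v => ?_) h0)
  rw [Real.dist_eq, abs_le]
  have h1 := ext_lip N L v w
  have h2 := ext_lip N L w v
  simp only [abs_sub_comm (w _) (v _)] at h2
  constructor <;> linarith

theorem ext_isSN {n : ℕ} (N : (Fin n → ℚ) → ℝ) (L : Fin n → ℝ)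
    (hN : ∀ q, 0 ≤ N q) (hs : ∀ (c : ℚ) q, N (c • q) = |(c : ℝ)| * N q)
    (ht : ∀ q r, N (q + r) ≤ N q + N r) (hL : ∀ q, N q ≤ ∑ i, |(q i : ℝ)| * |L i|) :
    IsSN (ext N L) := by
  have hq : ∀ q : Fin n → ℚ, ext N L (fun i => (q i : ℝ)) = N q := by
    intro q
    have key : ∀ r s : Fin n → ℚ, N r ≤ N s + ∑ i, |(r i : ℝ) - s i| * |L i| := by
      intro r s
      have h1 := ht s (r - s)
      have h2 := hL (r - s)
      rw [add_sub_cancel] at h1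
      simp only [Pi.sub_apply, Rat.cast_sub] at h2
      linarith
    refine ext_eq_of _ _ _ _ (fun r => ?_) (fun r => ?_)
    · rw [abs_of_nonneg (hN r)]; exact key q r
    · rw [abs_of_nonneg (hN r)]
      have := key r q
      simp only [abs_sub_comm (r _ : ℝ) (q _ : ℝ)] at this
      exact this
  have hd : DenseRange (fun (q : Fin n → ℚ) (i : Fin n) => (q i : ℝ)) :=
    DenseRange.piMap (fun _ => Rat.denseRange_cast)
  have hc := ext_cont N L
  refine ⟨fun v => le_ext _ _ _ _ fun q => by positivity, ?_, ?_, hc⟩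
  · have hd2 := (Rat.denseRange_cast (𝕜 := ℝ)).prodMap hd
    have := hd2.equalizer (g := fun z : ℝ × (Fin n → ℝ) => ext N L (z.1 • z.2))
      (h := fun z : ℝ × (Fin n → ℝ) => |z.1| * ext N L z.2) (by fun_prop) (by fun_prop) (by
        funext ⟨c, q⟩
        have h1 := hq (c • q)
        simp only [Pi.smul_apply, smul_eq_mul, Rat.cast_mul, hs] at h1
        simp only [Function.comp, Prod.map]
        rw [hq q, ← h1]
        rfl)
    intro c v
    exact congrFun this (c, v)
  · intro v w
    have hd2 := hd.prodMap hd
    have hcl : IsClosed {z : (Fin n → ℝ) × (Fin n → ℝ) |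
        ext N L (z.1 + z.2) ≤ ext N L z.1 + ext N L z.2} :=
      isClosed_le (by fun_prop) (by fun_prop)
    refine hd2.induction_on (p := fun z : (Fin n → ℝ) × (Fin n → ℝ) =>
        ext N L (z.1 + z.2) ≤ ext N L z.1 + ext N L z.2) (v, w) hcl ?_
    rintro ⟨q, r⟩
    have h1 := hq (q + r)
    simp only [Pi.add_apply, Rat.cast_add] at h1
    simp only [Prod.map]
    rw [hq q, hq r]
    exact (le_of_eq h1).trans (ht q r)

theorem ext_meas {Y : Type*} [MeasurableSpace Y] {n : ℕ} (N : (Fin n → ℚ) → Y → ℝ)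
    (L : Fin n → Y → ℝ) (hN : ∀ q, Measurable (N q)) (hL : ∀ i, Measurable (L i)) :
    Measurable (fun z : Y × (Fin n → ℝ) => ext (fun q => N q z.1) (fun i => L i z.1) z.2) := by
  unfold ext
  refine Measurable.iInf fun q => ?_
  refine Measurable.add ?_ (Finset.measurable_sum _ fun i _ => ?_)
  · exact ((hN q).comp measurable_fst).abs
  · exact (((measurable_pi_apply i).comp measurable_snd).sub_const _).abs.mul
      ((hL i).comp measurable_fst).abs

/-- nondegeneracy on the span of the first `j` basis vectors. -/
def Nondeg {n : ℕ} (p : (Fin n → ℝ) → ℝ) (j : ℕ) : Prop :=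
  ∃ c > 0, ∀ v : Fin n → ℝ, (∀ i : Fin n, j ≤ i.1 → v i = 0) → c * ‖v‖ ≤ p v

theorem nondeg_zero {n : ℕ} (p : (Fin n → ℝ) → ℝ) (hp : IsSN p) : Nondeg p 0 := by
  refine ⟨1, one_pos, fun v hv => ?_⟩
  have : v = 0 := funext fun i => hv i (Nat.zero_le _)
  rw [this]; simpa using hp.nonneg 0

theorem nondeg_succ {n : ℕ} (p : (Fin n → ℝ) → ℝ) (hp : IsSN p) (j : Fin n) (hj : Nondeg p j.1)
    (h : ∀ w : Fin n → ℝ, w j = 1 → (∀ i, j < i → w i = 0) → p w ≠ 0) : Nondeg p (j.1 + 1) := by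
  obtain ⟨c, hc, hcv⟩ := hj
  have hdef : ∀ v : Fin n → ℝ, (∀ i : Fin n, j.1 + 1 ≤ i.1 → v i = 0) → p v = 0 → v = 0 := by
    intro v hv hpv
    by_cases hvj : v j = 0
    · have := hcv v (fun i hi => by
        rcases Nat.eq_or_lt_of_le hi with e | l
        · rw [← Fin.ext e]; exact hvj
        · exact hv i l)
      rw [hpv] at this
      have h2 : ‖v‖ ≤ 0 := by nlinarith
      exact norm_le_zero_iff.1 h2
    · exfalso
      refine h ((v j)⁻¹ • v) (by simp [hvj]) (fun i hi => by simp [hv i hi]) ?_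
      rw [hp.smul, hpv, mul_zero]
  let K : Set (Fin n → ℝ) := {v | ‖v‖ = 1 ∧ ∀ i : Fin n, j.1 + 1 ≤ i.1 → v i = 0}
  have hK : IsCompact K := by
    have h1 : K = Metric.sphere (0 : Fin n → ℝ) 1 ∩
        {v | ∀ i : Fin n, j.1 + 1 ≤ i.1 → v i = 0} := by
      ext v; simp [K]
    rw [h1]
    refine (isCompact_sphere _ _).inter_right ?_
    simp only [Set.ofPred_forall]
    exact isClosed_iInter fun i => isClosed_iInter fun _ =>
      isClosed_eq (continuous_apply i) continuous_const
  rcases K.eq_empty_or_nonempty with he | hne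
  · refine ⟨1, one_pos, fun v hv => ?_⟩
    by_cases h0 : v = 0
    · rw [h0]; simpa using hp.nonneg 0
    · exfalso
      have : (‖v‖⁻¹ • v) ∈ K := ⟨by simp [norm_smul, norm_ne_zero_iff.2 h0], fun i hi => by simp [hv i hi]⟩
      rw [he] at this; exact this
  · obtain ⟨u, huK, hu⟩ := hK.exists_isMinOn hne hp.cont.continuousOn
    have hu0 : p u ≠ 0 := by
      intro h0
      have := hdef u huK.2 h0
      have h1 := huK.1
      rw [this] at h1; simp at h1
    refine ⟨p u, lt_of_le_of_ne (hp.nonneg u) hu0.symm, fun v hv => ?_⟩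
    by_cases h0 : v = 0
    · rw [h0]; simpa using hp.nonneg 0
    · have hvK : (‖v‖⁻¹ • v) ∈ K := ⟨by simp [norm_smul, norm_ne_zero_iff.2 h0], fun i hi => by simp [hv i hi]⟩
      have h2 : p u ≤ p (‖v‖⁻¹ • v) := hu hvK
      rw [hp.smul, abs_of_nonneg (by positivity)] at h2
      have h3 : 0 < ‖v‖ := norm_pos_iff.2 h0
      rwa [inv_mul_eq_div, le_div_iff₀ h3] at h2

theorem exists_sel {Y : Type*} [MeasurableSpace Y] {n : ℕ} (p : Y → (Fin n → ℝ) → ℝ)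
    (hp : Measurable (fun z : Y × (Fin n → ℝ) => p z.1 z.2)) (j : Fin n) :
    ∃ u : Y → Fin n → ℝ, Measurable u ∧ ∀ x, IsSN (p x) → Nondeg (p x) j.1 →
      ∀ w : Fin n → ℝ, w j = 1 → (∀ i, j < i → w i = 0) → p x w = 0 → u x = w := by
  classical
  obtain ⟨Q, hQ⟩ := exists_surjective_nat (Fin n → ℚ)
  let G : ℕ → ℕ → Y → Prop := fun k m x => p x (fun i => (Q m i : ℝ)) < 1 / ((k : ℝ) + 1) ∧
    (Q m j = 1 ∧ ∀ i, j < i → Q m i = 0)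
  have hG : ∀ k m, MeasurableSet {x | G k m x} := by
    intro k m
    refine MeasurableSet.inter ?_ (MeasurableSet.const _)
    exact measurableSet_lt (hp.comp (measurable_id.prodMk measurable_const)) measurable_const
  let G' : ℕ → ℕ → Y → Prop := fun k m x => G k m x ∨ ∀ m', ¬ G k m' x
  have hG' : ∀ k m, MeasurableSet {x | G' k m x} := by
    intro k m
    refine MeasurableSet.union (hG k m) ?_
    show MeasurableSet {x | ∀ m', ¬ G k m' x}
    simp only [Set.ofPred_forall]
    exact MeasurableSet.iInter fun m' => (hG k m').compl
  have hex : ∀ k x, ∃ m, G' k m x := by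
    intro k x
    by_cases h : ∃ m, G k m x
    · exact ⟨h.choose, Or.inl h.choose_spec⟩
    · exact ⟨0, Or.inr (not_exists.1 h)⟩
  let a : ℕ → Y → Fin n → ℝ := fun k x i => (Q (Nat.find (hex k x)) i : ℝ)
  have ha : ∀ k, Measurable (a k) := by
    intro k
    exact Measurable.find (f := fun m (_ : Y) => fun i => (Q m i : ℝ))
      (fun m => measurable_const) (hG' k) (hex k)
  refine ⟨fun x i => Filter.limsup (fun k => a k x i) Filter.atTop, ?_, ?_⟩
  · exact measurable_pi_lambda _ fun i =>
      Measurable.limsup fun k => (measurable_pi_apply i).comp (ha k)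
  intro x hx hnd w hw1 hw0 hpw
  obtain ⟨c, hc, hcv⟩ := hnd
  have hGe : ∀ k, ∃ m, G k m x := by
    intro k
    have hk : (0 : ℝ) < 1 / ((k : ℝ) + 1) := by positivity
    have hnear := (hx.cont.tendsto w).eventually (gt_mem_nhds (by rw [hpw]; exact hk))
    obtain ⟨δ, hδ, hb⟩ := Metric.eventually_nhds_iff.1 hnear
    obtain ⟨q, hq⟩ := exists_rat_approx w δ hδ
    obtain ⟨m, hm⟩ := hQ (fun i => if i < j then q i else if i = j then 1 else 0)
    refine ⟨m, ?_, ?_, ?_⟩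
    · refine hb ((dist_pi_lt_iff hδ).2 fun i => ?_)
      rw [hm, Real.dist_eq]
      rcases lt_trichotomy i j with h | h | h
      · simp only [h, if_true]; rw [abs_sub_comm]; exact hq i
      · simp [h, hw1, hδ]
      · simp [h.not_gt, h.ne', hw0 i h, hδ]
    · rw [hm]; simp
    · intro i hi; rw [hm]; simp [hi.not_gt, hi.ne']
  have haG : ∀ k, G k (Nat.find (hex k x)) x := by
    intro k
    rcases Nat.find_spec (hex k x) with h | h
    · exact h
    · exact absurd (hGe k) (not_exists.2 h)
  have hlim : Filter.Tendsto (fun k => a k x) Filter.atTop (nhds w) := by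
    have h0 : Filter.Tendsto (fun k : ℕ => c⁻¹ * (1 / ((k : ℝ) + 1))) Filter.atTop (nhds 0) := by
      simpa using (tendsto_one_div_add_atTop_nhds_zero_nat (𝕜 := ℝ)).const_mul c⁻¹
    refine tendsto_iff_norm_sub_tendsto_zero.2
      (squeeze_zero (fun _ => norm_nonneg _) (fun k => ?_) h0)
    obtain ⟨g1, g2, g3⟩ := haG k
    have h1 := hcv (a k x - w) (fun i hi => by
      rcases Nat.eq_or_lt_of_le hi with e | l
      · have : j = i := Fin.ext e
        subst this
        simp [a, g2, hw1]
      · simp [a, g3 i l, hw0 i l])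
    have h2 := hx.tri (a k x) ((-1 : ℝ) • w)
    rw [hx.smul, hpw, mul_zero, add_zero, neg_one_smul, ← sub_eq_add_neg] at h2
    rw [inv_mul_eq_div, le_div_iff₀ hc, mul_comm]
    exact (h1.trans h2).trans g1.le
  funext i
  exact ((tendsto_pi_nhds.1 hlim) i).limsup_eq


section modpart

variable {m' : Measure X} {M : Type*} [AddCommGroup M] [Module (X →ₘ[μ] ℝ) M]

/-- class of a measurable function -/
noncomputable def mkm (μ : Measure X) (g : X → ℝ) (hg : Measurable g) : X →ₘ[μ] ℝ :=
  AEEqFun.mk g hg.aestronglyMeasurable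

theorem mkm_coe (g : X → ℝ) (hg : Measurable g) : ⇑(mkm μ g hg) =ᵐ[μ] g := AEEqFun.coeFn_mk _ _

theorem mkm_congr {g h : X → ℝ} (hg : Measurable g) (hh : Measurable h) (e : g =ᵐ[μ] h) :
    mkm μ g hg = mkm μ h hh := AEEqFun.mk_eq_mk.2 e

theorem mkm_add {g h : X → ℝ} (hg : Measurable g) (hh : Measurable h) :
    mkm μ (fun x => g x + h x) (hg.add hh) = mkm μ g hg + mkm μ h hh := rfl

theorem mkm_mul {g h : X → ℝ} (hg : Measurable g) (hh : Measurable h) :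
    mkm μ (fun x => g x * h x) (hg.mul hh) = mkm μ g hg * mkm μ h hh := rfl

theorem mkm_neg {g : X → ℝ} (hg : Measurable g) :
    mkm μ (fun x => - g x) hg.neg = - mkm μ g hg := rfl

theorem mkm_surj (f : X →ₘ[μ] ℝ) : mkm μ f f.measurable = f := AEEqFun.mk_coeFn _

theorem mkm_zero : mkm μ (fun _ => 0) measurable_const = 0 := rfl

theorem mkm_eq_zero {g : X → ℝ} (hg : Measurable g) (h : mkm μ g hg = 0) : g =ᵐ[μ] 0 := by
  rw [← mkm_zero] at h
  exact AEEqFun.mk_eq_mk.1 h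

theorem chi_eq (A : Set X) (hA : MeasurableSet A) :
    chi μ A hA = mkm μ (A.indicator fun _ => 1) (measurable_const.indicator hA) := rfl

theorem chi_coe (A : Set X) (hA : MeasurableSet A) :
    ⇑(chi μ A hA) =ᵐ[μ] A.indicator fun _ => 1 := AEEqFun.coeFn_mk _ _

theorem chi_congr {A B : Set X} (hA : MeasurableSet A) (hB : MeasurableSet B) (h : A =ᵐ[μ] B) :
    chi μ A hA = chi μ B hB := by
  rw [chi_eq, chi_eq]
  exact mkm_congr _ _ (indicator_ae_eq_of_ae_eq_set h)

theorem chi_null {A : Set X} (hA : MeasurableSet A) (h : μ A = 0) : chi μ A hA = 0 := by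
  rw [chi_eq, ← mkm_zero]
  exact mkm_congr _ _ (indicator_meas_zero h)

theorem chi_mul_self (A : Set X) (hA : MeasurableSet A) :
    chi μ A hA * chi μ A hA = chi μ A hA := by
  rw [chi_eq, ← mkm_mul]
  refine mkm_congr _ _ (Filter.Eventually.of_forall fun x => ?_)
  by_cases hx : x ∈ A <;> simp [hx]

theorem chi_mul_disj {A B : Set X} (hA : MeasurableSet A) (hB : MeasurableSet B)
    (h : Disjoint A B) : chi μ A hA * chi μ B hB = 0 := by
  rw [chi_eq, chi_eq, ← mkm_mul, ← mkm_zero]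
  refine mkm_congr _ _ (Filter.Eventually.of_forall fun x => ?_)
  by_cases hx : x ∈ A
  · simp [Set.disjoint_left.1 h hx]
  · simp [hx]

variable (P : PtNormedMod μ m' M)
include P

theorem pn_neg (v : M) : ⇑(P.pn (-v)) =ᵐ[μ] P.pn v := by
  have h := P.pn_smul (mkm μ (fun _ => -1) measurable_const) v
  have e : mkm μ (fun _ => -1) measurable_const • v = -v := by
    have : mkm μ (fun _ => -1) measurable_const = -1 := rfl
    rw [this, neg_one_smul]
  rw [e] at h
  filter_upwards [h, mkm_coe (μ := μ) (fun _ => (-1:ℝ)) measurable_const] with x h1 h2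
  rw [h1, h2]; simp

theorem pn_zero : ⇑(P.pn 0) =ᵐ[μ] 0 := by
  have h := P.pn_smul 0 0
  rw [smul_zero] at h
  filter_upwards [h, AEEqFun.coeFn_zero (α := X) (μ := μ) (β := ℝ)] with x h1 h2
  rw [h1, h2]; simp

theorem pn_sum_le {ι : Type*} (s : Finset ι) (v : ι → M) :
    ∀ᵐ x ∂μ, P.pn (∑ i ∈ s, v i) x ≤ ∑ i ∈ s, P.pn (v i) x := by
  classical
  induction s using Finset.induction_on with
  | empty =>
    filter_upwards [pn_zero P] with x hx
    simp only [Finset.sum_empty, hx]; simp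
  | insert a s ha ih =>
    filter_upwards [ih, P.pn_add (v a) (∑ i ∈ s, v i)] with x h1 h2
    rw [Finset.sum_insert ha, Finset.sum_insert ha]
    linarith

theorem pn_sub_le (v w : M) : ∀ᵐ x ∂μ, P.pn v x ≤ P.pn w x + P.pn (v - w) x := by
  have := P.pn_add w (v - w)
  rwa [add_sub_cancel] at this

theorem pn_chi_smul (A : Set X) (hA : MeasurableSet A) (v : M) :
    ⇑(P.pn (chi μ A hA • v)) =ᵐ[μ] A.indicator (P.pn v) := by
  filter_upwards [P.pn_smul (chi μ A hA) v, chi_coe (μ := μ) A hA] with x h1 h2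
  rw [h1, h2]
  by_cases hx : x ∈ A <;> simp [hx]

theorem eq_of_chi {E : ℕ → Set X} (hE : ∀ n, MeasurableSet (E n)) (hU : (⋃ n, E n) = Set.univ)
    (v w : M) (h : ∀ n, chi μ (E n) (hE n) • v = chi μ (E n) (hE n) • w) : v = w := by
  rw [← sub_eq_zero]
  refine P.pn_definite _ ?_
  have h1 : ∀ n, ∀ᵐ x ∂μ, x ∈ E n → P.pn (v - w) x = 0 := by
    intro n
    have h2 : chi μ (E n) (hE n) • (v - w) = 0 := by rw [smul_sub, h n, sub_self]
    have h3 := pn_chi_smul P (E n) (hE n) (v - w)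
    rw [h2] at h3
    filter_upwards [h3, pn_zero P] with x a b hx
    rw [b, Set.indicator_of_mem hx] at a
    exact a.symm
  filter_upwards [ae_all_iff.2 h1] with x hx
  have : x ∈ ⋃ n, E n := by rw [hU]; trivial
  obtain ⟨n, hn⟩ := Set.mem_iUnion.1 this
  exact hx n hn

theorem min_int [IsProbabilityMeasure m'] (h₂ : m' ≪ μ) (v : M) :
    Integrable (fun x => min (P.pn v x) 1) m' := by
  refine Integrable.of_bound (C := 1)
    (((P.pn v).measurable.min measurable_const).aestronglyMeasurable) ?_
  filter_upwards [h₂.ae_le (P.pn_nonneg v)] with x hx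
  rw [Real.norm_eq_abs, abs_of_nonneg (le_min hx zero_le_one)]
  exact min_le_right _ _

theorem glueing [IsProbabilityMeasure m'] (h₁ : μ ≪ m') (h₂ : m' ≪ μ) : Glueing μ M := by
  intro v A hA hdisj
  let u : ℕ → M := fun N => ∑ n ∈ Finset.range N, chi μ (A n) (hA n) • v n
  have hchi : ∀ k N, chi μ (A k) (hA k) • u N =
      if k < N then chi μ (A k) (hA k) • v k else 0 := by
    intro k N
    simp only [u, Finset.smul_sum, smul_smul]
    have : ∀ n ∈ Finset.range N, (chi μ (A k) (hA k) * chi μ (A n) (hA n)) • v n =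
        if n = k then chi μ (A k) (hA k) • v k else 0 := by
      intro n _
      split_ifs with h
      · subst h; rw [chi_mul_self]
      · rw [chi_mul_disj _ _ (hdisj k n (Ne.symm h)), zero_smul]
    rw [Finset.sum_congr rfl this]
    simp
  -- tails
  let T : ℕ → Set X := fun N => ⋃ k ≥ N, A k
  have hT : ∀ N, MeasurableSet (T N) := fun N =>
    MeasurableSet.iUnion fun k => MeasurableSet.iUnion fun _ => hA k
  have hTlim : Filter.Tendsto (fun N => m'.real (T N)) Filter.atTop (nhds 0) := by
    have hanti : Antitone T := fun a b hab => Set.iUnion_mono fun k =>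
      Set.iUnion_mono' fun hk => ⟨hab.trans hk, subset_rfl⟩
    have h := tendsto_measure_iInter_atTop (μ := m') (s := T)
      (fun N => (hT N).nullMeasurableSet) hanti ⟨0, measure_ne_top _ _⟩
    have he : (⋂ N, T N) = ∅ := by
      rw [Set.eq_empty_iff_forall_notMem]
      intro x hx
      rw [Set.mem_iInter] at hx
      have h0 := hx 0
      simp only [T, Set.mem_iUnion] at h0
      obtain ⟨k, _, hk⟩ := h0
      have h1 := hx (k + 1)
      simp only [T, Set.mem_iUnion] at h1
      obtain ⟨l, hl, hl'⟩ := h1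
      exact Set.disjoint_left.1 (hdisj k l (by omega)) hk hl'
    rw [he, measure_empty] at h
    simpa [Measure.real, Function.comp_def] using
      (ENNReal.tendsto_toReal ENNReal.zero_ne_top).comp h
  have hsupp : ∀ N, ∀ p ≥ N, ∀ q ≥ N, ∀ᵐ x ∂μ, x ∉ T N → P.pn (u p - u q) x = 0 := by
    have aux : ∀ N, ∀ p ≥ N, ∀ᵐ x ∂μ, x ∉ T N → P.pn (u p - u N) x = 0 := by
      intro N p hp
      have e : u p - u N = ∑ n ∈ Finset.Ico N p, chi μ (A n) (hA n) • v n := by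
        rw [Finset.sum_Ico_eq_sub _ hp]
      rw [e]
      filter_upwards [pn_sum_le P (Finset.Ico N p) (fun n => chi μ (A n) (hA n) • v n),
        P.pn_nonneg (∑ n ∈ Finset.Ico N p, chi μ (A n) (hA n) • v n),
        ae_all_iff.2 fun n => pn_chi_smul P (A n) (hA n) (v n)] with x a b c hx
      refine le_antisymm (a.trans (le_of_eq ?_)) b
      refine Finset.sum_eq_zero fun n hn => ?_
      rw [c n, Set.indicator_of_notMem]
      intro hxn
      exact hx (Set.mem_iUnion₂.2 ⟨n, (Finset.mem_Ico.1 hn).1, hxn⟩)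
    intro N p hp q hq
    have e : u p - u q = (u p - u N) + -(u q - u N) := by abel
    rw [e]
    filter_upwards [aux N p hp, aux N q hq, P.pn_add (u p - u N) (-(u q - u N)),
      pn_neg P (u q - u N), P.pn_nonneg ((u p - u N) + -(u q - u N))] with x a b c d f hx
    rw [d, a hx, b hx] at c
    linarith
  obtain ⟨w, hw⟩ := P.complete u (by
    intro ε hε
    obtain ⟨N, hN⟩ := (hTlim.eventually (gt_mem_nhds hε)).exists
    refine ⟨N, fun p hp q hq => lt_of_le_of_lt ?_ hN⟩
    calc ∫ x, min (P.pn (u p - u q) x) 1 ∂m' ≤ ∫ x, (T N).indicator (fun _ => (1:ℝ)) x ∂m' := by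
          refine integral_mono_ae (min_int P h₂ _) ((integrable_const _).indicator (hT N)) ?_
          filter_upwards [h₂.ae_le (hsupp N p hp q hq)] with x hx
          by_cases h : x ∈ T N
          · simp [h]
          · simp [h, hx h]
      _ = m'.real (T N) := by rw [integral_indicator_const _ (hT N)]; simp)
  refine ⟨w, fun n => ?_⟩
  rw [eq_comm, ← sub_eq_zero, ← smul_sub]
  set z := chi μ (A n) (hA n) • (v n - w) with hz
  refine P.pn_definite _ ?_
  have hle : ∀ N > n, ∫ x, min (P.pn z x) 1 ∂m' ≤ ∫ x, min (P.pn (u N - w) x) 1 ∂m' := by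
    intro N hN
    refine integral_mono_ae (min_int P h₂ _) (min_int P h₂ _) ?_
    have e : z = chi μ (A n) (hA n) • (u N - w) := by
      rw [hz, smul_sub, smul_sub, hchi n N, if_pos hN]
    rw [e]
    filter_upwards [h₂.ae_le (pn_chi_smul P (A n) (hA n) (u N - w)),
      h₂.ae_le (P.pn_nonneg (u N - w))] with x a b
    refine min_le_min_right _ ?_
    rw [a]
    exact Set.indicator_le_self' (fun _ _ => b) x
  have h0 : ∫ x, min (P.pn z x) 1 ∂m' ≤ 0 :=
    ge_of_tendsto hw (Filter.eventually_atTop.2 ⟨n + 1, fun N hN => hle N hN⟩)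
  have hnn : 0 ≤ᵐ[m'] fun x => min (P.pn z x) 1 := by
    filter_upwards [h₂.ae_le (P.pn_nonneg z)] with x hx
    exact le_min hx zero_le_one
  have h3 := (integral_eq_zero_iff_of_nonneg_ae hnn (min_int P h₂ z)).1
    (le_antisymm h0 (integral_nonneg_of_ae hnn))
  filter_upwards [h₁.ae_le h3] with x hx
  have hx' : min (P.pn z x) 1 = 0 := hx
  rcases min_choice (P.pn z x) 1 with h | h <;> rw [h] at hx'
  · exact hx'
  · norm_num at hx'

omit P

/-- linear combination with measurable coefficients -/
noncomputable def comb (μ : Measure X) [Module (X →ₘ[μ] ℝ) M] {n : ℕ} (v : Fin n → M) (s : X → Fin n → ℝ) (hs : Measurable s) : M :=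
  ∑ i, mkm μ (fun x => s x i) ((measurable_pi_apply i).comp hs) • v i

theorem comb_add {n : ℕ} (v : Fin n → M) (s t : X → Fin n → ℝ) (hs : Measurable s)
    (ht : Measurable t) :
    comb μ v (fun x => s x + t x) (hs.add ht) = comb μ v s hs + comb μ v t ht := by
  simp only [comb, ← Finset.sum_add_distrib, ← add_smul]
  rfl

theorem comb_sub {n : ℕ} (v : Fin n → M) (s t : X → Fin n → ℝ) (hs : Measurable s)
    (ht : Measurable t) :
    comb μ v (fun x => s x - t x) (hs.sub ht) = comb μ v s hs - comb μ v t ht := by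
  simp only [comb, ← Finset.sum_sub_distrib, ← sub_smul]
  rfl

theorem comb_smul {n : ℕ} (v : Fin n → M) (g : X → ℝ) (s : X → Fin n → ℝ) (hg : Measurable g)
    (hs : Measurable s) :
    comb μ v (fun x => g x • s x) (hg.smul hs) = mkm μ g hg • comb μ v s hs := by
  simp only [comb, Finset.smul_sum, smul_smul]
  rfl

theorem comb_congr {n : ℕ} (v : Fin n → M) (s t : X → Fin n → ℝ) (hs : Measurable s)
    (ht : Measurable t) (h : s =ᵐ[μ] t) : comb μ v s hs = comb μ v t ht := by
  refine Finset.sum_congr rfl fun i _ => ?_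
  congr 1
  refine mkm_congr _ _ ?_
  filter_upwards [h] with x hx
  rw [hx]

include P

theorem pn_comb_le {n : ℕ} (v : Fin n → M) (s : X → Fin n → ℝ) (hs : Measurable s) :
    ∀ᵐ x ∂μ, P.pn (comb μ v s hs) x ≤ ∑ i, |s x i| * |P.pn (v i) x| := by
  have h1 : ∀ i, ∀ᵐ x ∂μ, P.pn (mkm μ (fun x => s x i) ((measurable_pi_apply i).comp hs) • v i) x
      = |s x i| * |P.pn (v i) x| := by
    intro i
    filter_upwards [P.pn_smul (mkm μ (fun x => s x i) ((measurable_pi_apply i).comp hs)) (v i),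
      mkm_coe (μ := μ) (fun x => s x i) ((measurable_pi_apply i).comp hs),
      P.pn_nonneg (v i)] with x a b c
    rw [a, b, abs_of_nonneg c]
  filter_upwards [pn_sum_le P Finset.univ
    (fun i => mkm μ (fun x => s x i) ((measurable_pi_apply i).comp hs) • v i),
    ae_all_iff.2 h1] with x a b
  exact a.trans (le_of_eq (Finset.sum_congr rfl fun i _ => b i))

/-- norm of rational combinations -/
noncomputable def NQ {n : ℕ} (v : Fin n → M) (q : Fin n → ℚ) : X → ℝ :=
  P.pn (comb μ v (fun _ i => (q i : ℝ)) measurable_const)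

/-- the bundle norm -/
noncomputable def bn {n : ℕ} (v : Fin n → M) (x : X) : (Fin n → ℝ) → ℝ :=
  ext (fun q => NQ P v q x) (fun i => P.pn (v i) x)

theorem bn_meas {n : ℕ} (v : Fin n → M) :
    Measurable (fun z : X × (Fin n → ℝ) => bn P v z.1 z.2) :=
  ext_meas (NQ P v) (fun i => P.pn (v i)) (fun _ => AEEqFun.measurable _)
    (fun _ => AEEqFun.measurable _)

theorem bn_isSN {n : ℕ} (v : Fin n → M) : ∀ᵐ x ∂μ, IsSN (bn P v x) := by
  have h1 : ∀ᵐ x ∂μ, ∀ q, 0 ≤ NQ P v q x := ae_all_iff.2 fun q => P.pn_nonneg _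
  have h2 : ∀ᵐ x ∂μ, ∀ (c : ℚ) (q : Fin n → ℚ), NQ P v (c • q) x = |(c : ℝ)| * NQ P v q x := by
    refine ae_all_iff.2 fun c => ae_all_iff.2 fun q => ?_
    have e : comb μ v (fun _ i => ((c • q) i : ℝ)) measurable_const =
        mkm μ (fun _ => (c : ℝ)) measurable_const •
          comb μ v (fun _ i => (q i : ℝ)) measurable_const := by
      rw [← comb_smul]
      refine comb_congr _ _ _ _ _ (Filter.Eventually.of_forall fun x => ?_)
      funext i; simp
    unfold NQ
    rw [e]
    filter_upwards [P.pn_smul (mkm μ (fun _ => (c : ℝ)) measurable_const)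
      (comb μ v (fun _ i => (q i : ℝ)) measurable_const),
      mkm_coe (μ := μ) (fun _ => (c : ℝ)) measurable_const] with x a b
    rw [a, b]
  have h3 : ∀ᵐ x ∂μ, ∀ q r : Fin n → ℚ, NQ P v (q + r) x ≤ NQ P v q x + NQ P v r x := by
    refine ae_all_iff.2 fun q => ae_all_iff.2 fun r => ?_
    have e : comb μ v (fun _ i => ((q + r) i : ℝ)) measurable_const =
        comb μ v (fun _ i => (q i : ℝ)) measurable_const +
          comb μ v (fun _ i => (r i : ℝ)) measurable_const := by
      rw [← comb_add]
      refine comb_congr _ _ _ _ _ (Filter.Eventually.of_forall fun x => ?_)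
      funext i; simp
    unfold NQ
    rw [e]
    exact P.pn_add _ _
  have h4 : ∀ᵐ x ∂μ, ∀ q : Fin n → ℚ, NQ P v q x ≤ ∑ i, |(q i : ℝ)| * |P.pn (v i) x| :=
    ae_all_iff.2 fun q => pn_comb_le P v _ _
  filter_upwards [h1, h2, h3, h4] with x a b c d
  exact ext_isSN _ _ a b c d

theorem pn_comb {n : ℕ} (v : Fin n → M) (s : X → Fin n → ℝ) (hs : Measurable s) :
    ⇑(P.pn (comb μ v s hs)) =ᵐ[μ] fun x => bn P v x (s x) := by
  have h : ∀ᵐ x ∂μ, ∀ q : Fin n → ℚ,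
      P.pn (comb μ v s hs) x ≤ |NQ P v q x| + ∑ i, |s x i - q i| * |P.pn (v i) x| ∧
      |NQ P v q x| ≤ P.pn (comb μ v s hs) x + ∑ i, |s x i - q i| * |P.pn (v i) x| := by
    refine ae_all_iff.2 fun q => ?_
    have hc : Measurable (fun (_ : X) (i : Fin n) => (q i : ℝ)) := measurable_const
    filter_upwards [pn_sub_le P (comb μ v s hs) (comb μ v _ hc), pn_sub_le P (comb μ v _ hc) (comb μ v s hs),
      pn_comb_le P v _ (hs.sub hc), pn_comb_le P v _ (hc.sub hs),
      P.pn_nonneg (comb μ v _ hc)] with x a b c d e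
    have e1 := comb_sub (μ := μ) v s _ hs hc
    have e2 := comb_sub (μ := μ) v _ s hc hs
    rw [← e1] at a
    rw [← e2] at b
    have d' : P.pn (comb μ v _ (hc.sub hs)) x ≤ ∑ i, |s x i - q i| * |P.pn (v i) x| := by
      refine d.trans (le_of_eq (Finset.sum_congr rfl fun i _ => ?_))
      rw [Pi.sub_apply, Pi.sub_apply, abs_sub_comm]
    have e' : |NQ P v q x| = P.pn (comb μ v _ hc) x := abs_of_nonneg e
    rw [e']
    exact ⟨a.trans (add_le_add_right c _), b.trans (add_le_add_right d' _)⟩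
  filter_upwards [h] with x hx
  exact (ext_eq_of _ _ _ _ (fun q => (hx q).1) (fun q => (hx q).2)).symm

omit P

theorem localBasis_indep {n : ℕ} {A : Set X} (hA : MeasurableSet A) {v : Fin n → M}
    (hv : LocalBasisOn μ A hA v) (s : X → Fin n → ℝ) (hs : Measurable s)
    (h : chi μ A hA • comb μ v s hs = 0) : ∀ᵐ x ∂μ, x ∈ A → s x = 0 := by
  have h1 := hv.2 (fun i => mkm μ (fun x => s x i) ((measurable_pi_apply i).comp hs)) (by
    rw [← h, comb, Finset.smul_sum]
    exact Finset.sum_congr rfl fun i _ => mul_smul _ _ _)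
  have h2 : ∀ i, ∀ᵐ x ∂μ, x ∈ A → s x i = 0 := by
    intro i
    have h3 := h1 i
    rw [chi_eq, ← mkm_mul] at h3
    filter_upwards [mkm_eq_zero _ h3] with x hx hxA
    simpa [hxA] using hx
  filter_upwards [ae_all_iff.2 h2] with x hx hxA
  exact funext fun i => hx i hxA

include P

theorem bn_nondeg {n : ℕ} {A : Set X} (hA : MeasurableSet A) {v : Fin n → M}
    (hv : LocalBasisOn μ A hA v) (j : ℕ) (hj : j ≤ n) :
    ∀ᵐ x ∂μ, x ∈ A → Nondeg (bn P v x) j := by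
  induction j with
  | zero =>
    filter_upwards [bn_isSN P v] with x hx _
    exact nondeg_zero _ hx
  | succ j ih =>
    have ih := ih (by omega)
    let J : Fin n := ⟨j, hj⟩
    obtain ⟨u, hu, hsel⟩ := exists_sel (bn P v) (bn_meas P v) J
    let D : Set X := {x | bn P v x (u x) = 0 ∧ u x J = 1}
    have hD : MeasurableSet D := by
      refine MeasurableSet.inter ?_ ?_
      · exact ((bn_meas P v).comp (measurable_id.prodMk hu)) (measurableSet_singleton 0)
      · exact ((measurable_pi_apply J).comp hu) (measurableSet_singleton 1)
    have hs : Measurable (D.indicator u) := hu.indicator hD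
    have hz : comb μ v _ hs = 0 := by
      refine P.pn_definite _ ?_
      filter_upwards [pn_comb P v _ hs, bn_isSN P v] with x a b
      rw [a]
      by_cases hx : x ∈ D
      · rw [Set.indicator_of_mem hx]; exact hx.1
      · rw [Set.indicator_of_notMem hx]
        simpa using b.smul 0 0
    have hind := localBasis_indep hA hv _ hs (by rw [hz, smul_zero])
    filter_upwards [ih, hind, bn_isSN P v] with x a b c hxA
    refine nondeg_succ _ c J (a hxA) fun w hw1 hw0 hpw => ?_
    have e := hsel x c (a hxA) w hw1 hw0 hpw
    have hx : x ∈ D := ⟨by rw [e, hpw], by rw [e, hw1]⟩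
    have h0 := b hxA
    rw [Set.indicator_of_mem hx] at h0
    have h1 := hx.2
    rw [h0] at h1
    simp at h1

omit P
end modpart

theorem localBasis_congr {μ : Measure X} {M : Type*} [AddCommGroup M] [Module (X →ₘ[μ] ℝ) M]
    {A B : Set X} (hA : MeasurableSet A) (hB : MeasurableSet B) {n : ℕ} {v : Fin n → M}
    (h : A =ᵐ[μ] B) (hv : LocalBasisOn μ A hA v) : LocalBasisOn μ B hB v := by
  unfold LocalBasisOn at *
  rwa [chi_congr hA hB h] at hv

theorem localBasis_null {μ : Measure X} {M : Type*} [AddCommGroup M] [Module (X →ₘ[μ] ℝ) M]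
    {A : Set X} (hA : MeasurableSet A) {n : ℕ} {v : Fin n → M}
    (h : μ A = 0) : LocalBasisOn μ A hA v := by
  unfold LocalBasisOn
  rw [chi_null hA h]
  exact ⟨fun w => ⟨0, by simp⟩, fun f _ i => zero_mul _⟩

theorem main_aux {μ m' : Measure X} [IsProbabilityMeasure m'] (h₁ : μ ≪ m') (h₂ : m' ≪ μ)
    {M : Type*} [AddCommGroup M] [Module (X →ₘ[μ] ℝ) M] (P : PtNormedMod μ m' M)
    (E : ℕ → Set X) (hE : ∀ n, MeasurableSet (E n)) (hd : ∀ n k, n ≠ k → Disjoint (E n) (E k))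
    (hU : (⋃ n, E n) = Set.univ) (v : (n : ℕ) → Fin n → M)
    (hv : ∀ n, LocalBasisOn μ (E n) (hE n) (v n)) :
    ∃ (B : MBB X μ) (I : Sec B → M),
      (∀ s t : Sec B, Sec.aeeq B s t → I s = I t) ∧
      (∀ s t : Sec B, I (Sec.add s t) = I s + I t) ∧
      (∀ (g : X → ℝ) (hg : Measurable g) (s : Sec B),
        I (Sec.smul g hg s) = (AEEqFun.mk g hg.aestronglyMeasurable : X →ₘ[μ] ℝ) • I s) ∧
      Function.Surjective I ∧
      (∀ s t : Sec B, I s = I t → Sec.aeeq B s t) ∧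
      (∀ s : Sec B, ⇑(P.pn (I s)) =ᵐ[μ] ptNorm B s) := by
  let B : MBB X μ :=
    { E := E
      measE := hE
      disjE := hd
      unionE := hU
      nrm := fun n => bn P (v n)
      meas_nrm := fun n => bn_meas P (v n)
      nrm_nonneg := fun n => (bn_isSN P (v n)).mono fun x h _ => h.nonneg
      nrm_definite := fun n => by
        filter_upwards [bn_nondeg P (hE n) (hv n) n le_rfl] with x h hx w hw
        obtain ⟨c, hc, hcv⟩ := h hx
        have h1 := hcv w (fun i hi => absurd i.2 (not_lt.2 hi))
        rw [hw] at h1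
        exact norm_le_zero_iff.1 (by nlinarith)
      nrm_smul := fun n => (bn_isSN P (v n)).mono fun x h _ => h.smul
      nrm_triangle := fun n => (bn_isSN P (v n)).mono fun x h _ => h.tri }
  have hglue := glueing P h₁ h₂
  have hI : ∀ s : Sec B, ∃ w : M, ∀ n, chi μ (E n) (hE n) • w =
      chi μ (E n) (hE n) • comb μ (v n) (s.val n) (s.meas n) :=
    fun s => hglue (fun n => comb μ (v n) (s.val n) (s.meas n)) E hE hd
  choose I hI using hI
  have heq := eq_of_chi P hE hU
  have hcongr : ∀ n (s t : X → Fin n → ℝ) (hs : Measurable s) (ht : Measurable t),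
      (∀ᵐ x ∂μ, x ∈ E n → s x = t x) →
      chi μ (E n) (hE n) • comb μ (v n) s hs = chi μ (E n) (hE n) • comb μ (v n) t ht := by
    intro n s t hs ht h
    rw [chi_eq, ← comb_smul, ← comb_smul]
    refine comb_congr _ _ _ _ _ ?_
    filter_upwards [h] with x hx
    by_cases hxE : x ∈ E n
    · rw [hx hxE]
    · simp [hxE]
  refine ⟨B, I, ?_, ?_, ?_, ?_, ?_, ?_⟩
  · intro s t hst
    refine heq _ _ fun n => ?_
    rw [hI, hI]
    exact hcongr n _ _ _ _ (hst n)
  · intro s t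
    refine heq _ _ fun n => ?_
    rw [smul_add, hI, hI, hI, ← smul_add, ← comb_add]
    rfl
  · intro g hg s
    refine heq _ _ fun n => ?_
    rw [smul_comm, hI, hI, smul_comm]
    congr 1
    exact comb_smul (μ := μ) (v n) g (s.val n) hg (s.meas n)
  · intro w
    choose f hf using fun n => (hv n).1 w
    let s : Sec B := ⟨fun n x i => f n i x, fun n =>
      measurable_pi_lambda _ fun i => (f n i).measurable⟩
    refine ⟨s, heq _ _ fun n => ?_⟩
    rw [hI, hf, comb, Finset.smul_sum]
    refine Finset.sum_congr rfl fun i _ => ?_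
    rw [mul_smul]
    congr 2
    exact mkm_surj (f n i)
  · intro s t hst n
    have h : chi μ (E n) (hE n) •
        comb μ (v n) (fun x => s.val n x - t.val n x) ((s.meas n).sub (t.meas n)) = 0 := by
      rw [comb_sub _ _ _ (s.meas n) (t.meas n), smul_sub, ← hI, ← hI, hst, sub_self]
    filter_upwards [localBasis_indep (hE n) (hv n) _ _ h] with x hx hxE
    exact sub_eq_zero.1 (hx hxE)
  · intro s
    have h : ∀ n, ∀ᵐ x ∂μ, x ∈ E n → P.pn (I s) x = bn P (v n) x (s.val n x) := by
      intro n
      have h1 := pn_chi_smul P (E n) (hE n) (I s)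
      rw [hI] at h1
      filter_upwards [h1, pn_chi_smul P (E n) (hE n) (comb μ (v n) (s.val n) (s.meas n)),
        pn_comb P (v n) (s.val n) (s.meas n)] with x a b c hx
      rw [b, Set.indicator_of_mem hx, Set.indicator_of_mem hx, c] at a
      exact a.symm
    filter_upwards [ae_all_iff.2 h] with x hx
    have : x ∈ ⋃ n, E n := by rw [hU]; trivial
    obtain ⟨n, hn⟩ := Set.mem_iUnion.1 this
    rw [hx n hn]
    unfold ptNorm
    rw [tsum_eq_single n]
    · exact (Set.indicator_of_mem (s := B.E n) hn (fun y => B.nrm n y (s.val n y))).symm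
    · intro k hk
      exact Set.indicator_of_notMem (s := B.E k)
        (fun h => Set.disjoint_left.1 (hd k n hk) h hn) _

/-- **Essential surjectivity of the section functor.** For every proper `L⁰(m)`-normed
`L⁰(m)`-module `M` over a metric measure space `(X,d,m)` there exists a measurable Banach
bundle `T` over `X` such that `Γ(T)` is isomorphic to `M`: there is a map `I` from
measurable sections of `T` to `M` which descends to a.e.-classes, is `L⁰(m)`-linear and
bijective (as a map on classes), and preserves the pointwise norm, `|I(s)| = |s|` m-a.e. -/
theorem exists_bundle_sections_isomorphic
    {X : Type*} [MetricSpace X] [CompleteSpace X] [SecondCountableTopology X]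
    [MeasurableSpace X] [BorelSpace X]
    (μ : Measure X) [IsLocallyFiniteMeasure μ] (hμ : μ ≠ 0)
    (m' : Measure X) [IsProbabilityMeasure m'] (h₁ : μ ≪ m') (h₂ : m' ≪ μ)
    (M : Type*) [AddCommGroup M] [Module (X →ₘ[μ] ℝ) M]
    (P : PtNormedMod μ m' M)
    (hproper : ∃ (E : ℕ → Set X) (hE : ∀ n, MeasurableSet (E n))
      (Einf : Set X) (hEinf : MeasurableSet Einf),
      DimDecomp μ M E hE Einf hEinf ∧ μ Einf = 0) :
    ∃ (B : MBB X μ) (I : Sec B → M),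
      (∀ s t : Sec B, Sec.aeeq B s t → I s = I t) ∧
      (∀ s t : Sec B, I (Sec.add s t) = I s + I t) ∧
      (∀ (g : X → ℝ) (hg : Measurable g) (s : Sec B),
        I (Sec.smul g hg s) = (AEEqFun.mk g hg.aestronglyMeasurable : X →ₘ[μ] ℝ) • I s) ∧
      Function.Surjective I ∧
      (∀ s t : Sec B, I s = I t → Sec.aeeq B s t) ∧
      (∀ s : Sec B, ⇑(P.pn (I s)) =ᵐ[μ] ptNorm B s) := by
  obtain ⟨E, hE, Einf, hEinf, ⟨hd, hdinf, hU, hb, -⟩, hnull⟩ := hproper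
  have hE' : ∀ n, MeasurableSet (if n = 0 then E 0 ∪ Einf else E n) := by
    intro n
    split_ifs
    · exact (hE 0).union hEinf
    · exact hE n
  have hae : ∀ n, E n =ᵐ[μ] (if n = 0 then E 0 ∪ Einf else E n : Set X) := by
    intro n
    split_ifs with h
    · subst h
      exact (union_ae_eq_left_of_ae_eq_empty (ae_eq_empty.2 hnull)).symm
    · exact Filter.EventuallyEq.rfl
  have hv : ∀ n, ∃ v : Fin n → M, LocalBasisOn μ (E n) (hE n) v := by
    intro n
    rcases eq_zero_or_pos (μ (E n)) with h | h
    · exact ⟨0, localBasis_null (hE n) h⟩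
    · exact hb n h
  choose v hv using hv
  refine main_aux h₁ h₂ P _ hE' ?_ ?_ v (fun n => localBasis_congr (hE n) (hE' n) (hae n) (hv n))
  · intro n k hnk
    rcases Nat.eq_zero_or_pos n with h | h <;> rcases Nat.eq_zero_or_pos k with h' | h'
    · omega
    · subst h
      simp only [if_true, h'.ne', if_false]
      exact (hd 0 k hnk).union_left (hdinf k).symm
    · subst h'
      simp only [if_true, h.ne', if_false]
      exact (hd n 0 hnk).union_right (hdinf n)
    · simp only [h.ne', h'.ne', if_false]
      exact hd n k hnk
  · rw [Set.eq_univ_iff_forall]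
    intro x
    have hx : x ∈ (⋃ n, E n) ∪ Einf := by rw [hU]; trivial
    rcases hx with hx | hx
    · obtain ⟨n, hn⟩ := Set.mem_iUnion.1 hx
      refine Set.mem_iUnion.2 ⟨n, ?_⟩
      split_ifs with h
      · subst h; exact Or.inl hn
      · exact hn
    · exact Set.mem_iUnion.2 ⟨0, by simp [hx]⟩

end L0SerreSwan
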